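/- For every n ≥ 0, the number of binary blocks of length 2n+1 that are n-step preimages of 1 under elementary cellular automaton rule 168 equals 3ⁿ, i.e., card 𝐟₁₆₈⁻ⁿ(1) = 3ⁿ. -/

import Mathlib

/-- Block evolution operator of a radius-1 elementary CA local rule:
it maps a block `b₁…b_m` (`m ≥ 3`) to the block of length `m-2` whose
`i`-th symbol is `f b_i b_{i+1} b_{i+2}`. -/
def blockMap (f : Bool → Bool → Bool → Bool) : List Bool → List Bool
  | a :: b :: c :: rest => f a b c :: blockMap f (b :: c :: rest)
  | _ => []

/-- Local rule 168: `f₁₆₈(x₁,x₂,x₃) = (x₁ ∨ x₂) ∧ x₃`. -/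
def f168 (x₁ x₂ x₃ : Bool) : Bool := (x₁ || x₂) && x₃

theorem blockMap_append_three (f : Bool → Bool → Bool → Bool) (l : List Bool) (x y z : Bool) :
    blockMap f (l ++ [x, y, z]) = blockMap f (l ++ [x, y]) ++ [f x y z] := by
  induction l with
  | nil => simp [blockMap]
  | cons a l ih =>
    rcases l with _ | ⟨b, _ | ⟨c, l⟩⟩ <;> simp_all [blockMap]

theorem blockMap_reverse (f : Bool → Bool → Bool → Bool) (l : List Bool) :
    blockMap f l.reverse = (blockMap (fun a b c => f c b a) l).reverse := by
  induction l with
  | nil => simp [blockMap]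
  | cons a l ih =>
    rcases l with _ | ⟨b, _ | ⟨c, l⟩⟩
    · simp [blockMap]
    · simp [blockMap]
    · have h := blockMap_append_three f l.reverse c b a
      simp_all [blockMap]

theorem blockMap_iterate_reverse (f : Bool → Bool → Bool → Bool) (n : ℕ) (l : List Bool) :
    (blockMap f)^[n] l.reverse = ((blockMap (fun a b c => f c b a))^[n] l).reverse := by
  induction n generalizing l with
  | zero => rfl
  | succ n ih => rw [Function.iterate_succ_apply, Function.iterate_succ_apply, blockMap_reverse, ih]

theorem length_blockMap (f : Bool → Bool → Bool → Bool) (l : List Bool) :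
    (blockMap f l).length = l.length - 2 := by
  induction l with
  | nil => simp [blockMap]
  | cons a l ih =>
    rcases l with _ | ⟨b, _ | ⟨c, l⟩⟩ <;> simp_all [blockMap]

theorem length_blockMap_iterate (f : Bool → Bool → Bool → Bool) (n : ℕ) (l : List Bool) :
    ((blockMap f)^[n] l).length = l.length - 2 * n := by
  induction n generalizing l with
  | zero => rfl
  | succ n ih =>
    rw [Function.iterate_succ_apply, ih, length_blockMap]
    omega

/-- The mirror image of rule 168. -/
def f168Mirror (a b c : Bool) : Bool := f168 c b a

/-- Whether a block starts with `n` consecutive words, each equal to `1` or `01`. -/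
def startsWithTokens : ℕ → List Bool → Bool
  | 0, _ => true
  | n + 1, true :: l => startsWithTokens n l
  | n + 1, false :: true :: l => startsWithTokens n l
  | _ + 1, _ => false

theorem startsWithTokens_succ (n : ℕ) (b c : Bool) (r : List Bool) (hr : 2 * n ≤ r.length) :
    startsWithTokens (n + 1) (b :: c :: r) =
      ((b || c) && startsWithTokens n (blockMap f168Mirror (b :: c :: r))) := by
  induction n generalizing b c r with
  | zero => cases b <;> cases c <;> simp [startsWithTokens]
  | succ n ih =>
    obtain _ | ⟨d, _ | ⟨e, r⟩⟩ := r
    · simp at hr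
    · simp at hr; omega
    have h₁ := ih c d (e :: r) (by simp at hr ⊢; omega)
    have h₂ := ih d e r (by simp at hr ⊢; omega)
    rw [blockMap] at h₁ ⊢
    rw [blockMap]
    generalize blockMap f168Mirror (d :: e :: r) = x at h₁ h₂ ⊢
    cases b <;> cases c <;> cases d <;>
      simp only [startsWithTokens, f168Mirror, f168, Bool.or_true, Bool.or_false, Bool.true_or,
        Bool.false_or, Bool.and_true, Bool.and_false, Bool.true_and, Bool.false_and] at h₁ h₂ ⊢ <;>
      cases e <;> simp_all [startsWithTokens]

theorem blockMap_iterate_cons (n : ℕ) (a : Bool) (l : List Bool) (hl : 2 * n ≤ l.length) :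
    (blockMap f168Mirror)^[n] (a :: l) =
      (a && startsWithTokens n l) :: (blockMap f168Mirror)^[n] l := by
  induction n generalizing a l with
  | zero => simp [startsWithTokens]
  | succ n ih =>
    obtain _ | ⟨b, _ | ⟨c, r⟩⟩ := l
    · simp at hl
    · simp at hl; omega
    have hr : 2 * n ≤ r.length := by simp at hl; omega
    rw [Function.iterate_succ_apply, Function.iterate_succ_apply, startsWithTokens_succ n b c r hr,
      blockMap, ih _ _ (by rw [length_blockMap]; simpa using hr)]
    cases a <;> cases b <;> cases c <;> simp [f168Mirror, f168]

theorem card_filter_ofFn_succ (m : ℕ) (p : List Bool → Bool) :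
    (Finset.univ.filter (fun b : Fin (m + 1) → Bool => p (List.ofFn b) = true)).card =
      (Finset.univ.filter (fun b : Fin m → Bool => p (true :: List.ofFn b) = true)).card +
      (Finset.univ.filter (fun b : Fin m → Bool => p (false :: List.ofFn b) = true)).card := by
  simp only [Finset.card_filter]
  rw [← (Fin.consEquiv (fun _ : Fin (m + 1) => Bool)).sum_comp, Fintype.sum_prod_type,
    Fintype.sum_bool]
  simp [Fin.consEquiv, List.ofFn_succ]

theorem card_startsWithTokens (n k : ℕ) :
    (Finset.univ.filter
      (fun b : Fin (2 * n + k) → Bool => startsWithTokens n (List.ofFn b) = true)).card =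
      3 ^ n * 2 ^ k := by
  induction n generalizing k with
  | zero => simp [startsWithTokens]
  | succ n ih =>
    rw [show 2 * (n + 1) + k = 2 * n + k + 1 + 1 by ring, card_filter_ofFn_succ,
      card_filter_ofFn_succ _ (fun l => startsWithTokens (n + 1) (false :: l))]
    refine (congrArg₂ (· + ·) (ih (k + 1)) (congrArg₂ (· + ·) (ih k)
      (by simp [startsWithTokens] : _ = 0))).trans ?_
    ring

theorem blockMap_f168_iterate_eq_iff (n : ℕ) (a : Bool) (l : List Bool) (hl : l.length = 2 * n) :
    (blockMap f168)^[n] (a :: l).reverse = [true] ↔ (a && startsWithTokens n l) = true := by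
  have h : (blockMap f168Mirror)^[n] l = [] := by
    rw [← List.length_eq_zero_iff, length_blockMap_iterate]
    omega
  rw [blockMap_iterate_reverse]
  change ((blockMap f168Mirror)^[n] (a :: l)).reverse = _ ↔ _
  rw [blockMap_iterate_cons n a l hl.ge, h]
  simp

/-- For every `n ≥ 0`, the number of blocks of length `2n+1` that are `n`-step
preimages of `1` under rule 168 equals `3ⁿ`. -/
theorem rule168_card_preimages (n : ℕ) :
    (Finset.univ.filter
        (fun b : Fin (2*n+1) → Bool =>
          (blockMap f168)^[n] (List.ofFn b) = [true])).card = 3 ^ n := by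
  have hrev : (Finset.univ.filter (fun b : Fin (2 * n + 1) → Bool =>
      (blockMap f168)^[n] (List.ofFn b) = [true])).card =
      (Finset.univ.filter (fun b : Fin (2 * n + 1) → Bool =>
        decide ((blockMap f168)^[n] (List.ofFn b).reverse = [true]) = true)).card := by
    simp only [Finset.card_filter]
    rw [← (Equiv.arrowCongr Fin.revPerm (Equiv.refl Bool)).sum_comp]
    refine Finset.sum_congr rfl fun b _ => ?_
    have : List.ofFn (Equiv.arrowCongr Fin.revPerm (Equiv.refl Bool) b) =
        (List.ofFn b).reverse := by
      refine List.ext_getElem (by simp) fun i _ _ => ?_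
      simp only [List.getElem_ofFn, List.getElem_reverse, List.length_ofFn]
      refine congrArg b (Fin.ext ?_)
      simp [Fin.rev]
    simp only [this, decide_eq_true_eq]
  rw [hrev, card_filter_ofFn_succ _ (fun l => decide ((blockMap f168)^[n] l.reverse = [true]))]
  simp only [decide_eq_true_eq, blockMap_f168_iterate_eq_iff n _ _ List.length_ofFn]
  simpa using card_startsWithTokens n 0
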